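/- arXiv:2011.12687 — 9 statements merged into one kernel-verified Lean document; each statement's English description precedes it below -/
import Mathlib

section
/- Let γ : ℝ → ℝ² be a twice continuously differentiable curve parametrized by arc length (‖γ'(t)‖ = 1 for all t), let p = γ(0), and let κ = ⟪γ''(0), J(γ'(0))⟫ be its signed curvature at p, where J is the rotation of ℝ² by π/2 (for the standard orientation). For s < 0 < u, let δ(s,u) denote the signed angle (with respect to the standard orientation of ℝ²) from the vector γ(0) − γ(s) to the vector γ(u) − γ(0). Then, as s → 0⁻ and u → 0⁺, the discrete curvature 2·δ(s,u) / (‖γ(0) − γ(s)‖ + ‖γ(u) − γ(0)‖) converges to κ. -/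
open Filter Real
open scoped RealInnerProductSpace Topology

noncomputable section

instance : Fact (Module.finrank ℝ (EuclideanSpace ℝ (Fin 2)) = 2) :=
  ⟨finrank_euclideanSpace_fin⟩

/-- The standard orientation of the Euclidean plane `ℝ²`. -/
def stdOrientation : Orientation ℝ (EuclideanSpace ℝ (Fin 2)) (Fin 2) :=
  (EuclideanSpace.basisFun (Fin 2) ℝ).toBasis.orientation

/-- Rotation of the plane by `π/2` with respect to the standard orientation. -/
def Jrot (v : EuclideanSpace ℝ (Fin 2)) : EuclideanSpace ℝ (Fin 2) :=
  stdOrientation.rotation ((Real.pi / 2 : ℝ) : Real.Angle) v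

lemma dc_wavg {ι : Type*} {l : Filter ι} {a b w : ι → ℝ} {L : ℝ}
    (ha : Tendsto a l (𝓝 L)) (hb : Tendsto b l (𝓝 L))
    (hw : ∀ᶠ i in l, 0 ≤ w i ∧ w i ≤ 1) :
    Tendsto (fun i => (1 - w i) * a i + w i * b i) l (𝓝 L) := by
  have h1 : Tendsto (fun i => min (a i) (b i)) l (𝓝 L) := by simpa using ha.min hb
  have h2 : Tendsto (fun i => max (a i) (b i)) l (𝓝 L) := by simpa using ha.max hb
  refine tendsto_of_tendsto_of_tendsto_of_le_of_le' h1 h2 ?_ ?_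
  · filter_upwards [hw] with i hi
    nlinarith [min_le_left (a i) (b i), min_le_right (a i) (b i)]
  · filter_upwards [hw] with i hi
    nlinarith [le_max_left (a i) (b i), le_max_right (a i) (b i)]

lemma dc_hasDerivAt_dslope {E : Type*} [NormedAddCommGroup E] [NormedSpace ℝ E]
    (γ : ℝ → E) (hγ : ContDiff ℝ 2 γ) :
    HasDerivAt (dslope γ 0) ((1 / 2 : ℝ) • deriv (deriv γ) 0) 0 := by
  have h := taylor_isLittleO_univ (f := γ) (x₀ := 0) (n := 2) (by exact_mod_cast hγ)
  have h2 : iteratedDeriv 2 γ = deriv (deriv γ) := by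
    rw [iteratedDeriv_succ, iteratedDeriv_one]
  simp only [taylorWithinEval_succ, taylor_within_zero_eval, iteratedDerivWithin_univ, h2,
    zero_add, iteratedDeriv_one, sub_zero] at h
  rw [hasDerivAt_iff_isLittleO, Asymptotics.isLittleO_iff]
  intro c hc
  filter_upwards [(Asymptotics.isLittleO_iff.1 h) hc] with t ht
  rcases eq_or_ne t 0 with rfl | h0
  · simp
  have e : γ t - (γ 0 + ((((0 : ℕ) + 1 : ℝ) * (Nat.factorial 0))⁻¹ * t ^ 1) • deriv γ 0
      + ((((1 : ℕ) + 1 : ℝ) * (Nat.factorial 1))⁻¹ * t ^ 2) • deriv (deriv γ) 0)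
      = t • (dslope γ 0 t - dslope γ 0 0 - (t - 0) • (1 / 2 : ℝ) • deriv (deriv γ) 0) := by
    rw [dslope_of_ne _ h0, dslope_same, slope_def_module]
    simp only [smul_sub, smul_smul, sub_zero]
    rw [mul_inv_cancel₀ h0]
    norm_num
    module
  have e2 : ‖t • (dslope γ 0 t - dslope γ 0 0 - (t - 0) • (1 / 2 : ℝ) • deriv (deriv γ) 0)‖
      ≤ c * ‖t ^ 2‖ := by
    rw [← e]
    convert ht using 5
  rw [norm_smul, norm_pow] at e2
  have : 0 < ‖t‖ := norm_pos_iff.2 h0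
  rw [sub_zero t] at *
  refine le_of_mul_le_mul_left ?_ this
  linarith

lemma dc_hasDerivAt_angle
    (d : ℝ → EuclideanSpace ℝ (Fin 2)) (A : EuclideanSpace ℝ (Fin 2))
    (hd : HasDerivAt d A 0) (h1 : ‖d 0‖ = 1) :
    HasDerivAt (fun t => Complex.arg (stdOrientation.kahler (d 0) (d t)))
      ⟪A, Jrot (d 0)⟫ 0 := by
  have hk := (stdOrientation.kahler (d 0)).toContinuousLinearMap.hasFDerivAt.comp_hasDerivAt
    (0 : ℝ) hd
  have hz : stdOrientation.kahler (d 0) (d 0) = 1 := by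
    rw [stdOrientation.kahler_apply_self, h1]; simp
  have hl := HasDerivAt.clog_real hk (by simp [hz])
  have hi := Complex.imCLM.hasFDerivAt.comp_hasDerivAt (0 : ℝ) hl
  have e : ⟪A, Jrot (d 0)⟫ = (stdOrientation.kahler (d 0) A).im := by
    rw [Jrot, Orientation.rotation_pi_div_two, real_inner_comm,
      Orientation.inner_rightAngleRotation_left, Orientation.kahler_apply_apply]
    simp
  simp only [Function.comp_apply, LinearMap.coe_toContinuousLinearMap', hz, div_one,
    Complex.imCLM_apply] at hi
  rw [e]
  exact hi.congr_of_eventuallyEq (Eventually.of_forall fun t => by simp [Complex.log_im])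

/-- The discrete curvature of V-lines closely inscribed on an arc-length
parametrized `C²` plane curve converges to the signed curvature. -/
theorem discrete_curvature_tendsto_curvature
    (γ : ℝ → EuclideanSpace ℝ (Fin 2)) (hγ : ContDiff ℝ 2 γ)
    (harc : ∀ t, ‖deriv γ t‖ = 1) (κ : ℝ)
    (hκ : κ = ⟪deriv (deriv γ) 0, Jrot (deriv γ 0)⟫)
    (δ : ℝ → ℝ → ℝ)
    (hδ : ∀ s u, δ s u = (stdOrientation.oangle (γ 0 - γ s) (γ u - γ 0)).toReal) :
    Tendsto (fun su : ℝ × ℝ =>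
        2 * δ su.1 su.2 / (‖γ 0 - γ su.1‖ + ‖γ su.2 - γ 0‖))
      ((𝓝[<] (0 : ℝ)) ×ˢ (𝓝[>] (0 : ℝ))) (𝓝 κ) := by
  set d := dslope γ 0 with hdd
  have hd := dc_hasDerivAt_dslope γ hγ
  have hd0 : d 0 = deriv γ 0 := dslope_same _ _
  have hn : ‖d 0‖ = 1 := by rw [hd0, harc]
  have hf := dc_hasDerivAt_angle d _ hd hn
  set f : ℝ → ℝ := fun t => Complex.arg (stdOrientation.kahler (d 0) (d t)) with hff
  have hf0 : f 0 = 0 := by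
    simp only [hff]
    rw [stdOrientation.kahler_apply_self, hn]; simp
  have hK : ⟪(1 / 2 : ℝ) • deriv (deriv γ) 0, Jrot (d 0)⟫ = κ / 2 := by
    rw [hκ, real_inner_smul_left, hd0]; ring
  rw [hK] at hf
  have hfs : Tendsto (fun t => t⁻¹ * f t) (𝓝[≠] 0) (𝓝 (κ / 2)) := by
    have := hasDerivAt_iff_tendsto_slope.1 hf
    refine this.congr fun t => ?_
    rw [slope_def_module, hf0]; simp
  have hdn : Tendsto (fun t => ‖d t‖) (𝓝[≠] 0) (𝓝 1) := by
    have := hd.continuousAt.norm.tendsto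
    rw [← hdd, hn] at this
    exact this.mono_left nhdsWithin_le_nhds
  have hdne : ∀ᶠ t in 𝓝[≠] (0 : ℝ), d t ≠ 0 := by
    filter_upwards [hdn.eventually (lt_mem_nhds (zero_lt_one))] with t ht
    exact norm_pos_iff.1 ht
  have hfsm : ∀ᶠ t in 𝓝[≠] (0 : ℝ), |f t| < 1 := by
    have := hf.continuousAt.abs.tendsto
    rw [hf0, abs_zero] at this
    exact (this.mono_left nhdsWithin_le_nhds).eventually (gt_mem_nhds zero_lt_one)
  have hg : ∀ t, γ t - γ 0 = t • d t := fun t => by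
    have := sub_smul_dslope γ 0 t
    simpa using this.symm
  have hl : 𝓝[<] (0 : ℝ) ≤ 𝓝[≠] 0 := nhdsWithin_mono _ fun x hx => ne_of_lt hx
  have hr : 𝓝[>] (0 : ℝ) ≤ 𝓝[≠] 0 := nhdsWithin_mono _ fun x hx => ne_of_gt hx
  have t1 : Tendsto (fun p : ℝ × ℝ => p.1) ((𝓝[<] (0 : ℝ)) ×ˢ (𝓝[>] (0 : ℝ))) (𝓝[≠] 0) :=
    tendsto_fst.mono_right hl
  have t2 : Tendsto (fun p : ℝ × ℝ => p.2) ((𝓝[<] (0 : ℝ)) ×ˢ (𝓝[>] (0 : ℝ))) (𝓝[≠] 0) :=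
    tendsto_snd.mono_right hr
  have n1 : ∀ᶠ p : ℝ × ℝ in (𝓝[<] (0 : ℝ)) ×ˢ (𝓝[>] (0 : ℝ)), p.1 < 0 :=
    tendsto_fst.eventually self_mem_nhdsWithin
  have n2 : ∀ᶠ p : ℝ × ℝ in (𝓝[<] (0 : ℝ)) ×ˢ (𝓝[>] (0 : ℝ)), 0 < p.2 :=
    tendsto_snd.eventually self_mem_nhdsWithin
  have hw : ∀ᶠ p : ℝ × ℝ in (𝓝[<] (0 : ℝ)) ×ˢ (𝓝[>] (0 : ℝ)),
      0 ≤ p.2 / (p.2 - p.1) ∧ p.2 / (p.2 - p.1) ≤ 1 := by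
    filter_upwards [n1, n2] with p h1 h2
    have : 0 < p.2 - p.1 := by linarith
    exact ⟨by positivity, by rw [div_le_one this]; linarith⟩
  have N := dc_wavg (hfs.comp t1) (hfs.comp t2) hw
  have D := dc_wavg (hdn.comp t1) (hdn.comp t2) hw
  have Q := (N.const_mul 2).div D one_ne_zero
  rw [show 2 * (κ / 2) / 1 = κ by ring] at Q
  refine Q.congr' ?_
  filter_upwards [n1, n2, t1.eventually hdne, t2.eventually hdne, t1.eventually hfsm,
    t2.eventually hfsm] with p h1 h2 z1 z2 s1 s2
  obtain ⟨s, u⟩ := p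
  simp only [Function.comp_apply, Pi.div_apply] at *
  have hus : 0 < u - s := by linarith
  have hx : γ 0 - γ s = (-s) • d s := by rw [neg_smul, ← hg, neg_sub]
  have hδv : δ s u = f u - f s := by
    rw [hδ, hx, hg, Orientation.oangle_smul_left_of_pos _ _ _ (neg_pos.2 h1),
      Orientation.oangle_smul_right_of_pos _ _ _ h2,
      ← stdOrientation.oangle_sub_left (x := d 0) (norm_pos_iff.1 (by rw [hn]; norm_num)) z1 z2]
    unfold Orientation.oangle
    rw [← Real.Angle.coe_sub, Real.Angle.toReal_coe_eq_self_iff]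
    rw [abs_lt] at s1 s2
    have := Real.pi_gt_three
    constructor <;> simp only [hff] at s1 s2 <;> linarith
  have p1 : 0 < ‖d s‖ := norm_pos_iff.2 z1
  have p2 : 0 < ‖d u‖ := norm_pos_iff.2 z2
  rw [hδv, hx, hg, norm_smul, norm_smul, Real.norm_of_nonneg (neg_pos.2 h1).le,
    Real.norm_of_nonneg h2.le]
  have e1 : 2 * ((1 - u / (u - s)) * (s⁻¹ * f s) + u / (u - s) * (u⁻¹ * f u))
      = 2 * (f u - f s) / (u - s) := by
    have := h1.ne
    field_simp
    ring
  have e2 : (1 - u / (u - s)) * ‖d s‖ + u / (u - s) * ‖d u‖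
      = (-s * ‖d s‖ + u * ‖d u‖) / (u - s) := by
    field_simp
    ring
  rw [e1, e2, div_div_div_cancel_right₀ hus.ne']

end
end

section
/- Let p₁, p, p₂ be three affinely independent (non-collinear) points in the Euclidean plane ℝ², and let R be the circumradius of the triangle with these vertices. Let α be the (unsigned) angle of the triangle at the vertex p₁ (the angle between p − p₁ and p₂ − p₁), let β be the angle at the vertex p₂ (the angle between p − p₂ and p₁ − p₂), and set δ = α + β (the exterior angle at p). Then 1/R = 4·sin(δ/2)·cos((α − β)/2) / (dist(p, p₁) + dist(p, p₂)). -/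
open Real EuclideanGeometry

noncomputable section

/-- For a nondegenerate triangle `p₁ p p₂` in the Euclidean plane with
circumradius `R`, base angles `α` at `p₁` and `β` at `p₂`, and angular defect
`δ = α + β`, the curvature `1/R` of the circumscribed circle equals
`4 sin(δ/2) cos((α - β)/2) / (dist p p₁ + dist p p₂)`. -/
theorem circumradius_eq_discrete_curvature
    (p₁ p p₂ : EuclideanSpace ℝ (Fin 2))
    (h : AffineIndependent ℝ ![p₁, p, p₂])
    (R α β δ : ℝ)
    (hR : R = (Affine.Simplex.mk ![p₁, p, p₂] h).circumradius)
    (hα : α = ∠ p p₁ p₂)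
    (hβ : β = ∠ p p₂ p₁)
    (hδ : δ = α + β) :
    1 / R = 4 * Real.sin (δ / 2) * Real.cos ((α - β) / 2) /
      (dist p p₁ + dist p p₂) := by
  have hpos : 0 < R := hR ▸ Affine.Simplex.circumradius_pos _
  have e1 : dist p p₂ / Real.sin α = 2 * R := by
    have := Affine.Triangle.dist_div_sin_angle_eq_two_mul_circumradius
      (Affine.Simplex.mk ![p₁, p, p₂] h)
      (i₁ := 1) (i₂ := 0) (i₃ := 2) (by decide) (by decide) (by decide)
    rw [hR, hα]
    simpa using this
  have e2 : dist p p₁ / Real.sin β = 2 * R := by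
    have := Affine.Triangle.dist_div_sin_angle_eq_two_mul_circumradius
      (Affine.Simplex.mk ![p₁, p, p₂] h)
      (i₁ := 1) (i₂ := 2) (i₃ := 0) (by decide) (by decide) (by decide)
    rw [hR, hβ]
    simpa using this
  have a0 : Real.sin α ≠ 0 := by
    intro h0
    rw [h0, div_zero] at e1
    linarith
  have b0 : Real.sin β ≠ 0 := by
    intro h0
    rw [h0, div_zero] at e2
    linarith
  have a1 : 0 < Real.sin α :=
    lt_of_le_of_ne (hα ▸ InnerProductGeometry.sin_angle_nonneg _ _) a0.symm
  have b1 : 0 < Real.sin β :=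
    lt_of_le_of_ne (hβ ▸ InnerProductGeometry.sin_angle_nonneg _ _) b0.symm
  rw [div_eq_iff a0] at e1
  rw [div_eq_iff b0] at e2
  have hs : 4 * Real.sin (δ / 2) * Real.cos ((α - β) / 2) = 2 * (Real.sin α + Real.sin β) := by
    have ha : α = δ / 2 + (α - β) / 2 := by rw [hδ]; ring
    have hb : β = δ / 2 - (α - β) / 2 := by rw [hδ]; ring
    have h1 : Real.sin α = Real.sin (δ / 2 + (α - β) / 2) := congrArg Real.sin ha
    have h2 : Real.sin β = Real.sin (δ / 2 - (α - β) / 2) := congrArg Real.sin hb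
    rw [h1, h2, Real.sin_add, Real.sin_sub]
    ring
  rw [hs, e1, e2, div_eq_div_iff hpos.ne' (by positivity)]
  ring

end
end

section
/- Let σ : ℝ → ℝ³ be a twice continuously differentiable curve lying on the unit sphere S² (‖σ(t)‖ = 1 for all t) and parametrized by arc length (‖σ'(t)‖ = 1 for all t), and let p = σ(0). Let κ_g = ⟪σ''(0), p × σ'(0)⟫ be the geodesic curvature of σ at p (the outward unit normal of S² at p being p itself, and × the cross product of ℝ³). For s < 0 < u with σ(s) ≠ ±p and σ(u) ≠ ±p, set p₁ = σ(s), p₂ = σ(u), let w(q) = q − ⟪p,q⟫·p be the tangential projection at p, let u₁ = −w(p₁)/‖w(p₁)‖ (the unit tangent vector at p of the great-circle geodesic from p₁ to p, in the direction of travel), u₂ = w(p₂)/‖w(p₂)‖ (the unit tangent vector at p of the great-circle geodesic from p to p₂), let δ(s,u) be the signed angle from u₁ to u₂ in the tangent plane at p, i.e., δ(s,u) = sign(⟪p, u₁ × u₂⟫)·arccos(⟪u₁, u₂⟫), and let l₁ = arccos⟪p, p₁⟫ and l₂ = arccos⟪p, p₂⟫ be the geodesic lengths from p to p₁ and p₂.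 Then, as s → 0⁻ and u → 0⁺, the discrete geodesic curvature 2·δ(s,u)/(l₁ + l₂) converges to κ_g. -/
open Filter Real
open scoped RealInnerProductSpace Topology

noncomputable section

/-- The cross product of two vectors of `ℝ³`. -/
def cross3 (a b : EuclideanSpace ℝ (Fin 3)) : EuclideanSpace ℝ (Fin 3) :=
  (WithLp.equiv 2 (Fin 3 → ℝ)).symm
    ![a 1 * b 2 - a 2 * b 1, a 2 * b 0 - a 0 * b 2, a 0 * b 1 - a 1 * b 0]


lemma aux_inner (x y : EuclideanSpace ℝ (Fin 3)) : ⟪x, y⟫ = x 0 * y 0 + x 1 * y 1 + x 2 * y 2 := by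
  simp [PiLp.inner_apply, Fin.sum_univ_three]; ring

lemma aux_gram (p x y : EuclideanSpace ℝ (Fin 3)) : ⟪p, cross3 x y⟫ ^ 2 =
    ⟪p, p⟫ * (⟪x, x⟫ * ⟪y, y⟫ - ⟪x, y⟫ ^ 2) - ⟪p, x⟫ * (⟪p, x⟫ * ⟪y, y⟫ - ⟪x, y⟫ * ⟪p, y⟫)
      + ⟪p, y⟫ * (⟪p, x⟫ * ⟪x, y⟫ - ⟪x, x⟫ * ⟪p, y⟫) := by
  simp only [aux_inner]
  simp [cross3]
  ring

lemma aux_binet (p T x y : EuclideanSpace ℝ (Fin 3)) :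
    ⟪T, T⟫ * ⟪p, cross3 x y⟫ - ⟪T, p⟫ * ⟪T, cross3 x y⟫ =
      ⟪x, T⟫ * ⟪y, cross3 p T⟫ - ⟪x, cross3 p T⟫ * ⟪y, T⟫ := by
  simp only [aux_inner]
  simp [cross3]
  ring

lemma aux_cross_left (p T : EuclideanSpace ℝ (Fin 3)) : ⟪p, cross3 p T⟫ = 0 := by
  simp only [aux_inner]
  simp [cross3]
  ring

lemma aux_cross_right (p T : EuclideanSpace ℝ (Fin 3)) : ⟪T, cross3 p T⟫ = 0 := by
  simp only [aux_inner]
  simp [cross3]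
  ring

/-- signed arccos is arcsin of the signed sine -/
lemma aux_sign_arccos (S c : ℝ) (hc : 0 ≤ c) (h : S ^ 2 = 1 - c ^ 2) :
    Real.sign S * Real.arccos c = Real.arcsin S := by
  rw [Real.arccos_eq_arcsin hc, ← h, Real.sqrt_sq_eq_abs]
  rcases lt_trichotomy S 0 with hS | hS | hS
  · rw [Real.sign_of_neg hS, abs_of_neg hS, Real.arcsin_neg]; ring
  · simp [hS]
  · rw [Real.sign_of_pos hS, abs_of_pos hS]; ring

/-- `arcsin x = x * k x` with `k` continuous at `0`, `k 0 = 1`. -/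
lemma aux_arcsin : ∃ k : ℝ → ℝ, (∀ x, Real.arcsin x = x * k x) ∧ Tendsto k (𝓝 0) (𝓝 1) := by
  have hd : HasDerivAt Real.arcsin 1 0 := by
    have := Real.hasDerivAt_arcsin (x := 0) (by norm_num) (by norm_num)
    simpa using this
  refine ⟨dslope Real.arcsin 0, fun x => ?_, ?_⟩
  · have := sub_smul_dslope Real.arcsin 0 x
    simp at this
    exact this.symm
  · have := (continuousAt_dslope_same.2 hd.differentiableAt).tendsto
    rwa [dslope_same, hd.deriv] at this

/-- second order Taylor limit -/
lemma aux_taylor (b : ℝ → ℝ) (b' : ℝ → ℝ) (κ : ℝ) (hb : ∀ t, HasDerivAt b (b' t) t)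
    (h0 : b 0 = 0) (h1 : b' 0 = 0) (h2 : HasDerivAt b' κ 0) :
    Tendsto (fun t => b t / t ^ 2) (𝓝[≠] 0) (𝓝 (κ / 2)) := by
  refine HasDerivAt.lhopital_zero_nhdsNE (f' := b') (g' := fun t => 2 * t) ?_ ?_ ?_ ?_ ?_ ?_
  · exact Eventually.of_forall hb
  · refine Eventually.of_forall fun t => ?_
    simpa using hasDerivAt_pow 2 t
  · filter_upwards [self_mem_nhdsWithin] with t ht
    have : t ≠ 0 := ht
    positivity
  · have := (hb 0).continuousAt.tendsto
    rw [h0] at this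
    exact this.mono_left nhdsWithin_le_nhds
  · have : Tendsto (fun t : ℝ => t ^ 2) (𝓝 0) (𝓝 (0 ^ 2)) := (continuous_pow 2).tendsto 0
    simp at this
    exact this.mono_left nhdsWithin_le_nhds
  · have := (hasDerivAt_iff_tendsto_slope.1 h2).div_const 2
    refine this.congr fun t => ?_
    simp [slope_def_field, h1, div_div, mul_comm]

/-- a convex combination of functions with a common limit -/
lemma aux_conv {α : Type*} {F : Filter α} (X Y lam : α → ℝ) (c : ℝ)
    (hX : Tendsto X F (𝓝 c)) (hY : Tendsto Y F (𝓝 c))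
    (hl : ∀ᶠ a in F, 0 ≤ lam a ∧ lam a ≤ 1) :
    Tendsto (fun a => X a * lam a + Y a * (1 - lam a)) F (𝓝 c) := by
  rw [tendsto_iff_dist_tendsto_zero]
  have h1 := (tendsto_iff_dist_tendsto_zero.1 hX).add (tendsto_iff_dist_tendsto_zero.1 hY)
  rw [add_zero] at h1
  refine squeeze_zero' (Eventually.of_forall fun _ => dist_nonneg) ?_ h1
  filter_upwards [hl] with a ha
  rw [Real.dist_eq, Real.dist_eq, Real.dist_eq]
  have : X a * lam a + Y a * (1 - lam a) - c = (X a - c) * lam a + (Y a - c) * (1 - lam a) := by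
    ring
  rw [this]
  refine (abs_add_le _ _).trans ?_
  rw [abs_mul, abs_mul, abs_of_nonneg ha.1, abs_of_nonneg (sub_nonneg.2 ha.2)]
  have := abs_nonneg (X a - c)
  have := abs_nonneg (Y a - c)
  nlinarith [ha.1, ha.2]

/-- For an arc-length parametrized `C²` curve `σ` on the unit sphere `S²`, the
discrete geodesic curvature of geodesic V-lines inscribed on `σ` around
`p = σ 0` converges to the geodesic curvature of `σ` at `p`. -/
theorem discrete_geodesic_curvature_tendsto_geodesic_curvature
    (σ : ℝ → EuclideanSpace ℝ (Fin 3)) (hσ : ContDiff ℝ 2 σ)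
    (hsph : ∀ t, ‖σ t‖ = 1) (harc : ∀ t, ‖deriv σ t‖ = 1)
    (p : EuclideanSpace ℝ (Fin 3)) (hp : p = σ 0) (κg : ℝ)
    (hκ : κg = ⟪deriv (deriv σ) 0, cross3 p (deriv σ 0)⟫)
    (w : EuclideanSpace ℝ (Fin 3) → EuclideanSpace ℝ (Fin 3))
    (hw : ∀ q, w q = q - ⟪p, q⟫ • p)
    (u₁ u₂ : ℝ → EuclideanSpace ℝ (Fin 3))
    (hu₁ : ∀ s, u₁ s = -(‖w (σ s)‖⁻¹ • w (σ s)))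
    (hu₂ : ∀ u, u₂ u = ‖w (σ u)‖⁻¹ • w (σ u))
    (δ : ℝ → ℝ → ℝ)
    (hδ : ∀ s u, δ s u =
      Real.sign ⟪p, cross3 (u₁ s) (u₂ u)⟫ * Real.arccos ⟪u₁ s, u₂ u⟫)
    (l : ℝ → ℝ) (hl : ∀ s, l s = Real.arccos ⟪p, σ s⟫)
    :
    Tendsto (fun su : ℝ × ℝ => 2 * δ su.1 su.2 / (l su.1 + l su.2))
      (((𝓝[<] (0 : ℝ)) ×ˢ (𝓝[>] (0 : ℝ))) ⊓
        Filter.principal {su : ℝ × ℝ |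
          σ su.1 ≠ p ∧ σ su.1 ≠ -p ∧ σ su.2 ≠ p ∧ σ su.2 ≠ -p})
      (𝓝 κg) := by
  set T := deriv σ 0 with hT
  set ν := cross3 p T with hν
  have hd : ∀ t, HasDerivAt σ (deriv σ t) t := fun t =>
    (hσ.differentiable (by norm_num) t).hasDerivAt
  have hd2 : HasDerivAt (deriv σ) (deriv (deriv σ) 0) 0 := by
    have h : ContDiff ℝ 1 (deriv σ) := by
      have h' : ContDiff ℝ (1 + 1) σ := by simpa [one_add_one_eq_two] using hσ
      exact (contDiff_succ_iff_deriv.1 h').2.2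
    exact (h.differentiable (by norm_num) 0).hasDerivAt
  have hpn : ‖p‖ = 1 := by rw [hp]; exact hsph 0
  have hTn : ‖T‖ = 1 := harc 0
  have hpp : ⟪p, p⟫ = 1 := by rw [real_inner_self_eq_norm_sq, hpn]; norm_num
  have hTT : ⟪T, T⟫ = 1 := by rw [real_inner_self_eq_norm_sq, hTn]; norm_num
  have hpT : ⟪p, T⟫ = 0 := by
    have h1 : HasDerivAt (fun t => ⟪σ t, σ t⟫) (⟪σ 0, deriv σ 0⟫ + ⟪deriv σ 0, σ 0⟫) 0 :=
      (hd 0).inner ℝ (hd 0)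
    have h2 : (fun t => ⟪σ t, σ t⟫) = fun _ => (1 : ℝ) := by
      funext t; rw [real_inner_self_eq_norm_sq, hsph]; norm_num
    rw [h2] at h1
    have h3 := h1.unique (hasDerivAt_const (0 : ℝ) (1 : ℝ))
    rw [real_inner_comm (σ 0) (deriv σ 0), ← hp] at h3
    have : ⟪p, deriv σ 0⟫ = ⟪deriv σ 0, p⟫ := real_inner_comm _ _
    linarith
  -- the projected curve
  have hwp : ∀ q, ⟪p, w q⟫ = 0 := by
    intro q; rw [hw, inner_sub_right, inner_smul_right, hpp]; ring
  have hwn : ∀ t, ‖w (σ t)‖ ^ 2 = 1 - ⟪p, σ t⟫ ^ 2 := by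
    intro t
    rw [← real_inner_self_eq_norm_sq]
    nth_rewrite 1 [hw]
    rw [inner_sub_left, inner_smul_left, hwp, hw, inner_sub_right, inner_smul_right,
      real_inner_self_eq_norm_sq, hsph, real_inner_comm p (σ t)]
    simp; ring
  have hwν : ∀ q, ⟪w q, ν⟫ = ⟪q, ν⟫ := by
    intro q; rw [hw, inner_sub_left, inner_smul_left, hν, aux_cross_left]; simp
  have hw0 : w (σ 0) = 0 := by rw [hw, ← hp, hpp]; simp
  have hdw : HasDerivAt (fun t => w (σ t)) T 0 := by
    have h1 : HasDerivAt (fun t => ⟪p, σ t⟫) (⟪p, deriv σ 0⟫ + ⟪(0 : EuclideanSpace ℝ (Fin 3)), σ 0⟫) 0 :=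
      (hasDerivAt_const (0 : ℝ) p).inner ℝ (hd 0)
    have h2 := (hd 0).sub (h1.smul_const p)
    have h3 : deriv σ 0 - (⟪p, deriv σ 0⟫ + ⟪(0 : EuclideanSpace ℝ (Fin 3)), σ 0⟫) • p = T := by
      rw [← hT, hpT]; simp
    rw [h3] at h2
    refine h2.congr_of_eventuallyEq (Eventually.of_forall fun t => ?_)
    simp [hw]
  set V : ℝ → EuclideanSpace ℝ (Fin 3) := fun t => t⁻¹ • w (σ t) with hV
  have hVlim : Tendsto V (𝓝[≠] 0) (𝓝 T) := by
    have := hasDerivAt_iff_tendsto_slope.1 hdw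
    refine this.congr fun t => ?_
    simp [slope_def_module, hw0, hV]
  set U : ℝ → EuclideanSpace ℝ (Fin 3) := fun t => ‖V t‖⁻¹ • V t with hU
  have hVn : Tendsto (fun t => ‖V t‖) (𝓝[≠] 0) (𝓝 1) := by
    have := hVlim.norm; rwa [hTn] at this
  have hVni : Tendsto (fun t => ‖V t‖⁻¹) (𝓝[≠] 0) (𝓝 1) := by
    have := hVn.inv₀ one_ne_zero; rwa [inv_one] at this
  have hUlim : Tendsto U (𝓝[≠] 0) (𝓝 T) := by
    have := hVni.smul hVlim; rwa [one_smul] at this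
  have hUu₂ : ∀ t, 0 < t → u₂ t = U t := by
    intro t ht
    simp only [hu₂, hU, hV, norm_smul, smul_smul, norm_inv, Real.norm_eq_abs, abs_of_pos ht,
      mul_inv, inv_inv]
    congr 1; field_simp
  have hUu₁ : ∀ t, t < 0 → u₁ t = U t := by
    intro t ht
    simp only [hu₁, hU, hV, norm_smul, smul_smul, norm_inv, Real.norm_eq_abs, abs_of_neg ht,
      mul_inv, inv_inv, ← neg_smul]
    congr 1; have := ht.ne; field_simp
  have hUp : ∀ t, ⟪p, U t⟫ = 0 := by
    intro t; simp only [hU, hV, inner_smul_right, hwp]; simp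
  have hUn : ∀ᶠ t in 𝓝[≠] (0 : ℝ), ⟪U t, U t⟫ = 1 := by
    filter_upwards [hVn.eventually_ne one_ne_zero] with t ht
    rw [real_inner_self_eq_norm_sq, hU]
    simp only [norm_smul, norm_inv, norm_norm]
    rw [inv_mul_cancel₀ ht]; norm_num
  have hUT : Tendsto (fun t => ⟪U t, T⟫) (𝓝[≠] 0) (𝓝 1) := by
    have h : Tendsto (fun t => ⟪U t, T⟫) (𝓝[≠] 0) (𝓝 ⟪T, T⟫) :=
      hUlim.inner tendsto_const_nhds
    rwa [hTT] at h
  -- second order behaviour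
  have hb : Tendsto (fun t => ⟪σ t, ν⟫ / t ^ 2) (𝓝[≠] 0) (𝓝 (κg / 2)) := by
    refine aux_taylor _ (fun t => ⟪deriv σ t, ν⟫) κg (fun t => ?_) ?_ ?_ ?_
    · have := (hd t).inner ℝ (hasDerivAt_const t ν)
      simpa using this
    · rw [← hp]; exact aux_cross_left p T
    · exact aux_cross_right p T
    · have := hd2.inner ℝ (hasDerivAt_const (0 : ℝ) ν)
      rw [hκ]; simpa using this
  have hUν : Tendsto (fun t => ⟪U t, ν⟫ / t) (𝓝[≠] 0) (𝓝 (κg / 2)) := by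
    have := hVni.mul hb
    rw [one_mul] at this
    refine this.congr fun t => ?_
    simp only [hU, hV, inner_smul_left, hwν]
    simp
    ring
  obtain ⟨k, hk, hklim⟩ := aux_arcsin
  -- lengths
  have hlt : Tendsto (fun t => l t / |t|) (𝓝[≠] 0) (𝓝 1) := by
    have hc : Tendsto (fun t => ⟪p, σ t⟫) (𝓝[≠] 0) (𝓝 1) := by
      have h : Tendsto (fun t => ⟪p, σ t⟫) (𝓝 0) (𝓝 ⟪p, σ 0⟫) :=
        (tendsto_const_nhds (x := p)).inner (hd 0).continuousAt.tendsto
      rw [← hp, hpp] at h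
      exact h.mono_left nhdsWithin_le_nhds
    have hr : Tendsto (fun t => ‖w (σ t)‖) (𝓝[≠] 0) (𝓝 0) := by
      have h := hdw.continuousAt.tendsto.norm
      simp only [hw0, norm_zero] at h
      exact h.mono_left nhdsWithin_le_nhds
    have := hVn.mul (hklim.comp hr)
    rw [one_mul] at this
    refine this.congr' ?_
    filter_upwards [hc.eventually_const_lt (show (0 : ℝ) < 1 by norm_num)] with t ht
    rw [hl, Real.arccos_eq_arcsin ht.le, ← hwn, Real.sqrt_sq (norm_nonneg _), hk]
    simp only [hV, norm_smul, norm_inv, Real.norm_eq_abs, Function.comp]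
    ring
  -- two-variable filter
  refine Tendsto.mono_left ?_ inf_le_left
  set F := (𝓝[<] (0 : ℝ)) ×ˢ (𝓝[>] (0 : ℝ)) with hF
  have f1 : Tendsto (fun su : ℝ × ℝ => su.1) F (𝓝[≠] 0) :=
    tendsto_fst.mono_right (nhdsWithin_mono _ fun x hx => ne_of_lt hx)
  have f2 : Tendsto (fun su : ℝ × ℝ => su.2) F (𝓝[≠] 0) :=
    tendsto_snd.mono_right (nhdsWithin_mono _ fun x hx => ne_of_gt hx)
  have n1 : ∀ᶠ su : ℝ × ℝ in F, su.1 < 0 :=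
    (tendsto_fst (f := 𝓝[<] (0 : ℝ)) (g := 𝓝[>] (0 : ℝ))).eventually self_mem_nhdsWithin
  have n2 : ∀ᶠ su : ℝ × ℝ in F, 0 < su.2 :=
    (tendsto_snd (f := 𝓝[<] (0 : ℝ)) (g := 𝓝[>] (0 : ℝ))).eventually self_mem_nhdsWithin
  set S : ℝ × ℝ → ℝ := fun su => ⟪p, cross3 (U su.1) (U su.2)⟫ with hS
  have hSeq : ∀ su, S su = ⟪U su.1, T⟫ * ⟪U su.2, ν⟫ - ⟪U su.1, ν⟫ * ⟪U su.2, T⟫ := by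
    intro su
    have := aux_binet p T (U su.1) (U su.2)
    rw [hTT, real_inner_comm p T, hpT] at this
    rw [hS, hν]; linarith
  have hlam : ∀ᶠ su : ℝ × ℝ in F, 0 ≤ su.2 / (su.2 - su.1) ∧ su.2 / (su.2 - su.1) ≤ 1 := by
    filter_upwards [n1, n2] with su h1 h2
    have : 0 < su.2 - su.1 := by linarith
    exact ⟨by positivity, by rw [div_le_one this]; linarith⟩
  have hSlim : Tendsto (fun su => S su / (su.2 - su.1)) F (𝓝 (κg / 2)) := by
    have hX := (hUT.comp f1).mul (hUν.comp f2)
    have hY := (hUT.comp f2).mul (hUν.comp f1)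
    rw [one_mul] at hX hY
    refine (aux_conv _ _ _ _ hX hY hlam).congr' ?_
    filter_upwards [n1, n2] with su h1 h2
    have h3 : su.2 - su.1 ≠ 0 := by linarith
    have h1' := h1.ne
    have h2' := h2.ne'
    rw [hSeq]
    simp only [Function.comp]
    field_simp
    ring
  have hLlim : Tendsto (fun su : ℝ × ℝ => (l su.1 + l su.2) / (su.2 - su.1)) F (𝓝 1) := by
    refine (aux_conv _ _ _ _ (hlt.comp f2) (hlt.comp f1) hlam).congr' ?_
    filter_upwards [n1, n2] with su h1 h2
    have h3 : su.2 - su.1 ≠ 0 := by linarith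
    have h1' := h1.ne
    have h2' := h2.ne'
    simp only [Function.comp, abs_of_neg h1, abs_of_pos h2]
    field_simp
    ring
  have hS0 : Tendsto S F (𝓝 0) := by
    have hz : Tendsto (fun su : ℝ × ℝ => su.2 - su.1) F (𝓝 0) := by
      have := (f2.mono_right nhdsWithin_le_nhds).sub (f1.mono_right nhdsWithin_le_nhds)
      simpa using this
    have := hSlim.mul hz
    rw [mul_zero] at this
    refine this.congr' ?_
    filter_upwards [n1, n2] with su h1 h2
    have h3 : su.2 - su.1 ≠ 0 := by linarith
    field_simp
  have hcos : Tendsto (fun su : ℝ × ℝ => ⟪U su.1, U su.2⟫) F (𝓝 1) := by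
    have : Tendsto (fun su : ℝ × ℝ => ⟪U su.1, U su.2⟫) F (𝓝 ⟪T, T⟫) :=
      (hUlim.comp f1).inner (hUlim.comp f2)
    rwa [hTT] at this
  have hfin := (((hklim.comp hS0).mul hSlim).const_mul 2).div hLlim one_ne_zero
  have hval : 2 * (1 * (κg / 2)) / 1 = κg := by ring
  rw [hval] at hfin
  refine hfin.congr' ?_
  filter_upwards [n1, n2, hcos.eventually_const_lt (show (0 : ℝ) < 1 by norm_num),
    f1.eventually hUn, f2.eventually hUn] with su h1 h2 hc e1 e2
  have h3 : su.2 - su.1 ≠ 0 := by linarith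
  have hδ' : δ su.1 su.2 = S su * k (S su) := by
    rw [hδ, hUu₁ _ h1, hUu₂ _ h2, ← hk]
    refine aux_sign_arccos _ _ hc.le ?_
    rw [aux_gram, hpp, hUp, hUp, e1, e2]; ring
  rw [hδ']
  simp only [Function.comp, Pi.div_apply]
  rw [mul_div_assoc', mul_div_assoc', div_div_div_cancel_right₀ h3]
  ring

end
end

section
/- Let σ : ℝ → ℝ³ be a twice continuously differentiable curve on the unit sphere S² (‖σ(t)‖ = 1) parametrized by arc length (‖σ'(t)‖ = 1), let p = σ(0), and assume σ(s) ≠ −p for s in a neighbourhood of 0. Define γ(s) = exp_p⁻¹(σ(s)), where for q ∈ S² with q ≠ ±p, exp_p⁻¹(q) = arccos(⟪p,q⟫) · (q − ⟪p,q⟫·p)/‖q − ⟪p,q⟫·p‖, and exp_p⁻¹(p) = 0. Then γ is twice differentiable at 0 with γ(0) = 0, γ'(0) = σ'(0), and ⟪γ''(0), p × σ'(0)⟫ = ⟪σ''(0), p × σ'(0)⟫; that is, the curvature at the origin of the pulled-back plane curve γ in the tangent plane T_pS² equals the geodesic curvature of σ at p. -/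
open Filter Real
open scoped RealInnerProductSpace Topology

noncomputable section

lemma aux_E {F : Type*} [NormedAddCommGroup F] [InnerProductSpace ℝ F]
    (w : ℝ → F) (hw : ContDiff ℝ 2 w) (w0 : w 0 = 0) (hw1 : deriv w 0 ≠ 0)
    (k : ℝ → ℝ) (hk : AnalyticAt ℝ k 0) (k0 : k 0 = 0) (k1 : deriv k 0 = 0) :
    (∀ᶠ s in 𝓝 (0:ℝ), DifferentiableAt ℝ (fun s => k ‖w s‖ • w s) s) ∧
    deriv (fun s => k ‖w s‖ • w s) 0 = 0 ∧
    HasDerivAt (deriv (fun s => k ‖w s‖ • w s)) 0 0 := by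
  have hwd : Differentiable ℝ w := hw.differentiable (by norm_num)
  have hwd1 : Continuous (deriv w) := hw.continuous_deriv (by norm_num)
  have hwO : w =O[𝓝 0] (fun s : ℝ => s) := by
    simpa [w0] using (hwd 0).hasDerivAt.isBigO_sub
  have hn0 : Tendsto (fun s => ‖w s‖) (𝓝 0) (𝓝 0) := by
    have := hwd.continuous.norm.tendsto 0
    simpa [w0] using this
  have hkd : DifferentiableAt ℝ k 0 := hk.differentiableAt
  have hko : k =o[𝓝 0] (fun u : ℝ => u) := by
    have := hasDerivAt_iff_isLittleO.1 hkd.hasDerivAt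
    simpa [k0, k1] using this
  have hkw : (fun s => k ‖w s‖) =o[𝓝 0] (fun s : ℝ => s) :=
    ((hko.comp_tendsto hn0).trans_isBigO hwO.norm_left)
  have hkev : ∀ᶠ u in 𝓝 (0:ℝ), DifferentiableAt ℝ k u := by
    filter_upwards [hk.eventually_analyticAt] with u hu
    exact hu.differentiableAt
  have hkc : ContinuousAt (deriv k) 0 := hk.deriv.continuousAt
  have hk' : Tendsto (fun s => deriv k ‖w s‖) (𝓝 0) (𝓝 0) := by
    have h := hkc.tendsto
    rw [k1] at h
    exact h.comp hn0
  have hE0 : HasDerivAt (fun s => k ‖w s‖ • w s) 0 0 := by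
    rw [hasDerivAt_iff_isLittleO]
    have h1 : w =O[𝓝 0] (fun _ : ℝ => (1:ℝ)) := hwd.continuous.continuousAt.isBigO_one ℝ
    simpa [w0] using hkw.smul_isBigO h1
  have hne : ∀ᶠ s in 𝓝[≠] (0:ℝ), w s ≠ 0 := (hwd 0).hasDerivAt.eventually_ne hw1
  have hne' : ∀ᶠ s in 𝓝 (0:ℝ), s ≠ 0 → w s ≠ 0 := eventually_nhdsWithin_iff.1 hne
  have hD : ∀ᶠ s in 𝓝 (0:ℝ), s ≠ 0 → HasDerivAt (fun s => k ‖w s‖ • w s)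
      (k ‖w s‖ • deriv w s + (deriv k ‖w s‖ * (⟪w s, deriv w s⟫ / ‖w s‖)) • w s) s := by
    filter_upwards [hne', hn0.eventually hkev] with s h1 h2 hs
    have hws := h1 hs
    have hnp : ‖w s‖ ≠ 0 := norm_ne_zero_iff.2 hws
    have hn : HasDerivAt (fun s => ‖w s‖) (⟪w s, deriv w s⟫ / ‖w s‖) s := by
      have := ((hwd s).hasDerivAt.norm_sq).sqrt (by positivity)
      simp only [Real.sqrt_sq (norm_nonneg _)] at this
      convert this using 1
      field_simp
    exact (h2.hasDerivAt.comp s hn).smul (hwd s).hasDerivAt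
  refine ⟨?_, hE0.deriv, ?_⟩
  · filter_upwards [hD] with s hs
    by_cases h : s = 0
    · subst h; exact hE0.differentiableAt
    · exact (hs h).differentiableAt
  · rw [hasDerivAt_iff_isLittleO]
    simp only [hE0.deriv, sub_zero, smul_zero]
    have hw'1 : (deriv w) =O[𝓝 0] (fun _ : ℝ => (1:ℝ)) := hwd1.continuousAt.isBigO_one ℝ
    have t1 : (fun s => k ‖w s‖ • deriv w s) =o[𝓝 0] (fun s : ℝ => s) := by
      simpa using hkw.smul_isBigO hw'1
    have t0 : (fun s => deriv k ‖w s‖ * (⟪w s, deriv w s⟫ / ‖w s‖)) =o[𝓝 0]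
        (fun _ : ℝ => (1:ℝ)) := by
      have hb : (fun s => ⟪w s, deriv w s⟫ / ‖w s‖) =O[𝓝 0] (fun _ : ℝ => (1:ℝ)) := by
        refine Asymptotics.IsBigO.trans (Asymptotics.isBigO_of_le _ fun s => ?_) hw'1
        rw [norm_div, norm_norm]
        refine div_le_of_le_mul₀ (norm_nonneg _) (norm_nonneg _) ?_
        rw [mul_comm]
        exact norm_inner_le_norm _ _
      have ha := (Asymptotics.isLittleO_one_iff ℝ).2 hk'
      simpa using ha.mul_isBigO hb
    have t2 : (fun s => (deriv k ‖w s‖ * (⟪w s, deriv w s⟫ / ‖w s‖)) • w s) =o[𝓝 0]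
        (fun s : ℝ => s) := by
      simpa using t0.smul_isBigO hwO
    refine (t1.add t2).congr' ?_ EventuallyEq.rfl
    filter_upwards [hD] with s hs
    by_cases h : s = 0
    · subst h; simp [hE0.deriv, w0, k0]
    · exact (hs h).deriv.symm

lemma aux_h : ∃ k : ℝ → ℝ, AnalyticAt ℝ k 0 ∧ k 0 = 0 ∧ deriv k 0 = 0 ∧
    ∀ u, u ≠ 0 → k u = Real.arcsin u * u⁻¹ - 1 := by
  have ha : AnalyticAt ℝ Real.arcsin 0 := by
    have := Real.contDiffAt_arcsin (x := 0) (n := ⊤) (by norm_num) (by norm_num)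
    exact this.analyticAt
  obtain ⟨q, hq⟩ := ha
  have hd := hq.has_fpower_series_dslope_fslope
  have hder : deriv Real.arcsin 0 = 1 := by simp [Real.deriv_arcsin]
  refine ⟨fun u => dslope Real.arcsin 0 u - 1, hd.analyticAt.sub analyticAt_const, ?_, ?_, ?_⟩
  · simp [hder]
  · have hev : ∀ u, dslope Real.arcsin 0 (-u) = dslope Real.arcsin 0 u := by
      intro u
      by_cases h : u = 0
      · simp [h]
      · rw [dslope_of_ne _ h, dslope_of_ne _ (neg_ne_zero.2 h)]
        simp [slope]
    have h1 := deriv_comp_neg (dslope Real.arcsin 0) 0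
    simp only [hev] at h1
    rw [deriv_sub_const]
    have h2 : deriv (fun u => dslope Real.arcsin 0 u) 0 = deriv (dslope Real.arcsin 0) 0 := rfl
    rw [neg_zero] at h1
    linarith
  · intro u hu
    simp only [dslope_of_ne _ hu, slope]
    simp [mul_comm]

/-- For an arc-length parametrized `C²` curve `σ` on the unit sphere with
`p = σ 0`, the pull-back `γ = exp_p⁻¹ ∘ σ` to the tangent plane at `p` is twice
differentiable at `0`, with `γ 0 = 0`, `γ' 0 = σ' 0`, and the curvature of `γ`
at the origin equal to the geodesic curvature of `σ` at `p`. -/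
theorem invExp_pullback_preserves_geodesic_curvature
    (σ : ℝ → EuclideanSpace ℝ (Fin 3)) (hσ : ContDiff ℝ 2 σ)
    (hsph : ∀ t, ‖σ t‖ = 1) (harc : ∀ t, ‖deriv σ t‖ = 1)
    (p : EuclideanSpace ℝ (Fin 3)) (hp : p = σ 0)
    (hne : ∀ᶠ s in 𝓝 (0 : ℝ), σ s ≠ -p)
    (invExp : EuclideanSpace ℝ (Fin 3) → EuclideanSpace ℝ (Fin 3))
    (hinvExp : ∀ q, q ≠ p → q ≠ -p →
      invExp q = Real.arccos ⟪p, q⟫ •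
        (‖q - ⟪p, q⟫ • p‖⁻¹ • (q - ⟪p, q⟫ • p)))
    (hinvExpP : invExp p = 0)
    (γ : ℝ → EuclideanSpace ℝ (Fin 3))
    (hγ : ∀ s, γ s = invExp (σ s)) :
    γ 0 = 0 ∧
    (∀ᶠ s in 𝓝 (0 : ℝ), DifferentiableAt ℝ γ s) ∧
    DifferentiableAt ℝ (deriv γ) 0 ∧
    deriv γ 0 = deriv σ 0 ∧
    ⟪deriv (deriv γ) 0, cross3 p (deriv σ 0)⟫ =
      ⟪deriv (deriv σ) 0, cross3 p (deriv σ 0)⟫ := by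
  obtain ⟨k, hk, k0, k1, hku⟩ := aux_h
  have hσd : Differentiable ℝ σ := hσ.differentiable (by norm_num)
  have hσd2 : Differentiable ℝ (deriv σ) := hσ.differentiable_deriv_two
  have hpn : ‖p‖ = 1 := by rw [hp]; exact hsph 0
  have hpp : ⟪p, p⟫ = 1 := by rw [real_inner_self_eq_norm_sq, hpn]; norm_num
  have hperp : ⟪p, deriv σ 0⟫ = 0 := by
    have h1 := (hσd 0).hasDerivAt.norm_sq
    have h2 : (fun t => ‖σ t‖ ^ 2) = fun _ => (1:ℝ) := by
      funext t; rw [hsph t]; norm_num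
    rw [h2] at h1
    have h3 := h1.unique (hasDerivAt_const (0:ℝ) (1:ℝ))
    rw [← hp] at h3
    linarith
  set w : ℝ → EuclideanSpace ℝ (Fin 3) := fun s => σ s - ⟪p, σ s⟫ • p with hwdef
  have hw : ContDiff ℝ 2 w := hσ.sub ((contDiff_const.inner ℝ hσ).smul contDiff_const)
  have hcd : ∀ (f : ℝ → EuclideanSpace ℝ (Fin 3)), Differentiable ℝ f → ∀ s,
      HasDerivAt (fun s => f s - ⟪p, f s⟫ • p) (deriv f s - ⟪p, deriv f s⟫ • p) s := by
    intro f hf s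
    have h1 := (hasDerivAt_const s p).inner ℝ (hf s).hasDerivAt
    simp only [inner_zero_left, add_zero] at h1
    exact (hf s).hasDerivAt.sub (h1.smul_const p)
  have hdw : deriv w = fun s => deriv σ s - ⟪p, deriv σ s⟫ • p :=
    funext fun s => (hcd σ hσd s).deriv
  have hddw : deriv (deriv w) 0 = deriv (deriv σ) 0 - ⟪p, deriv (deriv σ) 0⟫ • p := by
    rw [hdw]; exact (hcd _ hσd2 0).deriv
  have hdw0 : deriv w 0 = deriv σ 0 := by rw [hdw]; simp [hperp]
  have w0 : w 0 = 0 := by simp [hwdef, ← hp, hpn]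
  have hw1 : deriv w 0 ≠ 0 := by
    rw [hdw0]; intro h; have := harc 0; rw [h] at this; simp at this
  obtain ⟨e1, e2, e3⟩ := aux_E w hw w0 hw1 k hk k0 k1
  set E : ℝ → EuclideanSpace ℝ (Fin 3) := fun s => k ‖w s‖ • w s with hE
  have hwd : Differentiable ℝ w := hw.differentiable (by norm_num)
  have hwd2 : Differentiable ℝ (deriv w) := hw.differentiable_deriv_two
  have hpos : ∀ᶠ s in 𝓝 (0:ℝ), 0 < ⟪p, σ s⟫ := by
    have hc : Continuous fun s => ⟪p, σ s⟫ := continuous_const.inner hσd.continuous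
    refine hc.continuousAt.eventually (lt_mem_nhds ?_)
    simp [← hp, hpn]
  have hγE : γ =ᶠ[𝓝 0] fun s => w s + E s := by
    filter_upwards [hne, hpos] with s h1 h2
    rw [hγ]
    by_cases h : σ s = p
    · have : w s = 0 := by simp [hwdef, h, hpn]
      simp [hE, this, h, hinvExpP]
    · rw [hinvExp _ h h1]
      have hww : σ s - ⟪p, σ s⟫ • p = w s := rfl
      rw [hww]
      by_cases hz : w s = 0
      · simp [hE, hz]
      · have hnz : ‖w s‖ ≠ 0 := norm_ne_zero_iff.2 hz
        have hsq : ‖w s‖ ^ 2 = 1 - ⟪p, σ s⟫ ^ 2 := by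
          rw [← hww, norm_sub_sq_real, hsph, inner_smul_right, norm_smul, hpn,
            real_inner_comm, Real.norm_eq_abs, mul_one, sq_abs]
          ring
        have hac : Real.arccos ⟪p, σ s⟫ = Real.arcsin ‖w s‖ := by
          rw [Real.arccos_eq_arcsin h2.le, ← hsq, Real.sqrt_sq (norm_nonneg _)]
        simp only [hE]
        rw [hac, hku _ hnz, sub_smul, one_smul, smul_smul]
        abel
  have hdγ : deriv γ =ᶠ[𝓝 0] fun s => deriv w s + deriv E s := by
    filter_upwards [hγE.eventuallyEq_nhds, e1] with s h1 h2
    rw [h1.deriv_eq]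
    exact deriv_fun_add (hwd s) h2
  have hdd : HasDerivAt (deriv γ) (deriv (deriv w) 0) 0 := by
    have := (hwd2 0).hasDerivAt.add e3
    rw [add_zero] at this
    exact this.congr_of_eventuallyEq hdγ
  refine ⟨?_, ?_, hdd.differentiableAt, ?_, ?_⟩
  · rw [hγ, ← hp, hinvExpP]
  · filter_upwards [hγE.eventuallyEq_nhds, e1] with s h1 h2
    exact ((hwd s).add h2).congr_of_eventuallyEq h1
  · rw [hdγ.eq_of_nhds, e2, add_zero, hdw0]
  · have hcr : ⟪p, cross3 p (deriv σ 0)⟫ = 0 := by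
      simp [cross3, PiLp.inner_apply, Fin.sum_univ_three]
      ring
    rw [hdd.deriv, hddw, inner_sub_left, inner_smul_left, hcr]
    simp

end
end

section
/- Let δ : ℕ → ℤ → ℝ be a family of doubly-indexed real numbers (δ_i^j for j ∈ ℕ, i ∈ ℤ) such that sup_{i∈ℤ} |δ_i^0| is finite, and suppose that for all j ∈ ℕ and i ∈ ℤ: (a) |δ_{2i+1}^{j+1}| ≤ (1/4)·(|δ_i^j| + |δ_{i+1}^j|), and (b) δ_{2i}^{j+1} = (1/8)·(−δ_{i−1}^j + 6·δ_i^j − δ_{i+1}^j). Set δ^j = sup_{i∈ℤ} |δ_i^j|. Then δ^j is finite for every j, δ^{j+2} ≤ (7/8)·δ^j for every j, and the series ∑_j δ^j converges. -/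
open Filter

/-- Summability of the maximal angular defects of the 4-point SBIGS-scheme:
if the doubly indexed defects satisfy the 4-point recursions, then the
suprema `δ^j = sup_i |δ_i^j|` are finite, satisfy `δ^{j+2} ≤ (7/8) δ^j`, and
form a summable sequence. -/
theorem sbigs_defects_summable
    (δ : ℕ → ℤ → ℝ)
    (h0 : ∃ M : ℝ, ∀ i : ℤ, |δ 0 i| ≤ M)
    (ha : ∀ (j : ℕ) (i : ℤ),
      |δ (j + 1) (2 * i + 1)| ≤ (1 / 4) * (|δ j i| + |δ j (i + 1)|))
    (hb : ∀ (j : ℕ) (i : ℤ),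
      δ (j + 1) (2 * i) = (1 / 8) * (-δ j (i - 1) + 6 * δ j i - δ j (i + 1))) :
    (∀ j : ℕ, BddAbove (Set.range fun i : ℤ => |δ j i|)) ∧
    (∀ j : ℕ, (⨆ i : ℤ, |δ (j + 2) i|) ≤ (7 / 8) * ⨆ i : ℤ, |δ j i|) ∧
    Summable (fun j : ℕ => ⨆ i : ℤ, |δ j i|) := by
  have hodd : ∀ (j : ℕ) (M : ℝ), (∀ i, |δ j i| ≤ M) →
      ∀ i, |δ (j + 1) (2 * i + 1)| ≤ M / 2 := by
    intro j M h i
    have h1 := ha j i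
    have h2 := h i
    have h3 := h (i + 1)
    linarith
  have heven : ∀ (j : ℕ) (i : ℤ), |δ (j + 1) (2 * i)| ≤
      (1 / 8) * (|δ j (i - 1)| + 6 * |δ j i| + |δ j (i + 1)|) := by
    intro j i
    rw [hb j i, abs_le]
    have h1 := abs_le.1 (le_refl |δ j (i - 1)|)
    have h2 := abs_le.1 (le_refl |δ j i|)
    have h3 := abs_le.1 (le_refl |δ j (i + 1)|)
    constructor <;> linarith [h1.1, h1.2, h2.1, h2.2, h3.1, h3.2]
  have hstep : ∀ (j : ℕ) (M : ℝ), (∀ i, |δ j i| ≤ M) → ∀ i, |δ (j + 1) i| ≤ M := by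
    intro j M h i
    have hM : 0 ≤ M := (abs_nonneg _).trans (h 0)
    obtain ⟨k, rfl | rfl⟩ := Int.even_or_odd' i
    · linarith [heven j k, h (k - 1), h k, h (k + 1)]
    · linarith [hodd j M h k]
  have hstep2 : ∀ (j : ℕ) (M : ℝ), (∀ i, |δ j i| ≤ M) →
      ∀ i, |δ (j + 2) i| ≤ 7 / 8 * M := by
    intro j M h i
    have hM : 0 ≤ M := (abs_nonneg _).trans (h 0)
    have h1 := hstep j M h
    have ho := hodd j M h
    obtain ⟨k, rfl | rfl⟩ := Int.even_or_odd' i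
    · have he := heven (j + 1) k
      obtain ⟨l, rfl | rfl⟩ := Int.even_or_odd' k
      · have ho' := ho (l - 1)
        rw [show 2 * (l - 1) + 1 = 2 * l - 1 by ring] at ho'
        linarith [h1 (2 * l), ho l]
      · linarith [h1 (2 * l + 1 - 1), h1 (2 * l + 1 + 1), ho l]
    · have he := ha (j + 1) k
      have := h1 k
      have := h1 (k + 1)
      linarith
  have hbd : ∀ j : ℕ, ∃ M : ℝ, ∀ i : ℤ, |δ j i| ≤ M := by
    intro j
    induction j with
    | zero => exact h0
    | succ j ih =>
      obtain ⟨M, hM⟩ := ih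
      exact ⟨M, hstep j M hM⟩
  have hB : ∀ j : ℕ, BddAbove (Set.range fun i : ℤ => |δ j i|) := by
    intro j
    obtain ⟨M, hM⟩ := hbd j
    exact ⟨M, by rintro _ ⟨i, rfl⟩; exact hM i⟩
  have h78 : ∀ j : ℕ, (⨆ i : ℤ, |δ (j + 2) i|) ≤ (7 / 8) * ⨆ i : ℤ, |δ j i| :=
    fun j => ciSup_le (hstep2 j _ (fun i => le_ciSup (hB j) i))
  have hnn : ∀ j : ℕ, 0 ≤ ⨆ i : ℤ, |δ j i| :=
    fun j => Real.iSup_nonneg (fun i => abs_nonneg _)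
  refine ⟨hB, h78, ?_⟩
  generalize hs : (fun j : ℕ => ⨆ i : ℤ, |δ j i|) = s
  have h78' : ∀ j, s (j + 2) ≤ 7 / 8 * s j := by subst hs; exact h78
  have hnn' : ∀ j, 0 ≤ s j := by subst hs; exact hnn
  have key : ∀ n, ∑ i ∈ Finset.range n, s i + 8 * (s n + s (n + 1)) ≤ 8 * (s 0 + s 1) := by
    intro n
    induction n with
    | zero => simp
    | succ n ih =>
      rw [Finset.sum_range_succ]
      have := h78' n
      linarith
  refine summable_of_sum_range_le (c := 8 * (s 0 + s 1)) hnn' (fun n => ?_)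
  linarith [key n, hnn' n, hnn' (n + 1)]
end

section
/- Let (α_j), (β_j), (δ_j), (e_j), (f_j), (d_j) be real sequences with e_j > 0, f_j > 0, d_j > 0 for all j, such that α_j → 0, β_j → 0, δ_j → 0, e_j → 0, f_j → 0 and d_j → 0 as j → ∞, and satisfying for all j the Darboux relation of spherical triangles: cos((α_j − β_j)/2) / cos(δ_j/2) = sin((e_j + f_j)/2) / sin(d_j/2). If the sequence κ_j = 2·δ_j/(e_j + f_j) converges to a limit L ∈ ℝ, then the sequence 2·sin(δ_j)/d_j also converges to L. -/
open Filter Real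
open scoped Topology

/-- For sequences of spherical-triangle data tending to zero and satisfying
the Darboux relation, the discrete geodesic curvature `2 δ_j / (e_j + f_j)`
and the quantity `2 sin δ_j / d_j` have the same limit. -/
theorem darboux_discrete_curvature_limit
    (α β δ e f d : ℕ → ℝ)
    (he : ∀ j, 0 < e j) (hf : ∀ j, 0 < f j) (hd : ∀ j, 0 < d j)
    (hα : Tendsto α atTop (𝓝 0))
    (hβ : Tendsto β atTop (𝓝 0))
    (hδ : Tendsto δ atTop (𝓝 0))
    (he0 : Tendsto e atTop (𝓝 0))
    (hf0 : Tendsto f atTop (𝓝 0))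
    (hd0 : Tendsto d atTop (𝓝 0))
    (hdarboux : ∀ j,
      Real.cos ((α j - β j) / 2) / Real.cos (δ j / 2) =
        Real.sin ((e j + f j) / 2) / Real.sin (d j / 2))
    (L : ℝ)
    (hκ : Tendsto (fun j => 2 * δ j / (e j + f j)) atTop (𝓝 L)) :
    Tendsto (fun j => 2 * Real.sin (δ j) / d j) atTop (𝓝 L) := by
  have hsx : ∀ x : ℝ, Real.sin x = x * Real.sinc x := by
    intro x
    by_cases hx : x = 0
    · simp [hx]
    · rw [Real.sinc_of_ne_zero hx]; field_simp
  have hsinc : ∀ u : ℕ → ℝ, Tendsto u atTop (𝓝 0) →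
      Tendsto (fun j => Real.sinc (u j)) atTop (𝓝 1) := by
    intro u hu
    have h := (Real.continuous_sinc.tendsto 0).comp hu
    rwa [Real.sinc_zero] at h
  have hcos : ∀ u : ℕ → ℝ, Tendsto u atTop (𝓝 0) →
      Tendsto (fun j => Real.cos (u j)) atTop (𝓝 1) := by
    intro u hu
    have h := (Real.continuous_cos.tendsto 0).comp hu
    rwa [Real.cos_zero] at h
  have hs2 : Tendsto (fun j => (e j + f j) / 2) atTop (𝓝 0) := by
    simpa using (he0.add hf0).div_const 2
  have hd2 : Tendsto (fun j => d j / 2) atTop (𝓝 0) := by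
    simpa using hd0.div_const 2
  have hδ2 : Tendsto (fun j => δ j / 2) atTop (𝓝 0) := by
    simpa using hδ.div_const 2
  have hab : Tendsto (fun j => (α j - β j) / 2) atTop (𝓝 0) := by
    simpa using (hα.sub hβ).div_const 2
  have key := ((((hκ.mul (hsinc _ hδ)).mul
    ((hcos _ hab).div (hcos _ hδ2) one_ne_zero)).mul (hsinc _ hd2)).div
      (hsinc _ hs2) one_ne_zero)
  simp only [mul_one, div_one] at key
  refine key.congr' ?_
  filter_upwards [(hsinc _ hd2).eventually_ne one_ne_zero,
    (hsinc _ hs2).eventually_ne one_ne_zero] with j h1 h2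
  have hs : e j + f j ≠ 0 := (add_pos (he j) (hf j)).ne'
  have hdj : d j ≠ 0 := (hd j).ne'
  simp only [Pi.div_apply, Pi.mul_apply]
  rw [hdarboux j, hsx (δ j), hsx ((e j + f j) / 2), hsx (d j / 2)]
  generalize Real.sinc ((e j + f j) / 2) = A at *
  generalize Real.sinc (d j / 2) = B at *
  generalize e j + f j = S at *
  field_simp
end

section
/- Let A be the 3×3 rational (or real) matrix A = [[2,2,0],[−1,6,−1],[0,2,2]]. Then for every natural number j, the matrix (1/8^j)·A^j equals the matrix with rows: row 1 = (−j/2^{j+2} + 1/2^{j+1} + 1/2^{2j+1}, j/2^{j+1}, −j/2^{j+2} + 1/2^{j+1} − 1/2^{2j+1}); row 2 = (−j/2^{j+2}, (j+2)/2^{j+1}, −j/2^{j+2}); row 3 = (−j/2^{j+2} + 1/2^{j+1} − 1/2^{2j+1}, j/2^{j+1}, −j/2^{j+2} + 1/2^{j+1} + 1/2^{2j+1}). -/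
/-- Closed form for the powers of the matrix governing the evolution of the
angular defects in the planar angle-based 4-point subdivision scheme. -/
theorem angle_matrix_pow
    (A : Matrix (Fin 3) (Fin 3) ℝ)
    (hA : A = !![2, 2, 0; -1, 6, -1; 0, 2, 2]) (j : ℕ) :
    (1 / 8 ^ j : ℝ) • A ^ j =
      !![-(j : ℝ) / 2 ^ (j + 2) + 1 / 2 ^ (j + 1) + 1 / 2 ^ (2 * j + 1),
           (j : ℝ) / 2 ^ (j + 1),
           -(j : ℝ) / 2 ^ (j + 2) + 1 / 2 ^ (j + 1) - 1 / 2 ^ (2 * j + 1);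
         -(j : ℝ) / 2 ^ (j + 2),
           ((j : ℝ) + 2) / 2 ^ (j + 1),
           -(j : ℝ) / 2 ^ (j + 2);
         -(j : ℝ) / 2 ^ (j + 2) + 1 / 2 ^ (j + 1) - 1 / 2 ^ (2 * j + 1),
           (j : ℝ) / 2 ^ (j + 1),
           -(j : ℝ) / 2 ^ (j + 2) + 1 / 2 ^ (j + 1) + 1 / 2 ^ (2 * j + 1)] := by
  induction j with
  | zero =>
    ext a b
    fin_cases a <;> fin_cases b <;> norm_num
  | succ k ih =>
    have h : (1 / 8 ^ (k + 1) : ℝ) • A ^ (k + 1)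
        = ((1 / 8 ^ k : ℝ) • A ^ k) * ((1 / 8 : ℝ) • A) := by
      rw [pow_succ A, smul_mul_smul_comm]
      congr 1
      rw [pow_succ]
      field_simp
    rw [h, ih, hA]
    have h2 : (2 : ℝ) ^ k ≠ 0 := by positivity
    ext a b
    fin_cases a <;> fin_cases b <;>
      simp [Matrix.mul_apply, Fin.sum_univ_three, pow_succ, pow_mul', mul_add] <;>
      field_simp <;> ring
end

section
/- Let x₀, y₀ ∈ ℝ and define sequences (x_j), (y_j) by the recursions x_{j+1} = (3·x_j − y_j)/4 and y_{j+1} = (x_j + y_j)/4. Then for every natural number j: x_j = ((2 + j)·x₀ − j·y₀)/2^{j+1} and y_j = (j·x₀ + (2 − j)·y₀)/2^{j+1}. -/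
/-- Closed form for the coupled recursions satisfied by the central and
adjacent angular defects of the planar angle-based 4-point scheme applied to a
symmetric five-point polygon. -/
theorem angle_recursion_closed_form
    (x₀ y₀ : ℝ) (x y : ℕ → ℝ)
    (hx0 : x 0 = x₀) (hy0 : y 0 = y₀)
    (hx : ∀ j : ℕ, x (j + 1) = (3 * x j - y j) / 4)
    (hy : ∀ j : ℕ, y (j + 1) = (x j + y j) / 4) :
    ∀ j : ℕ,
      x j = ((2 + (j : ℝ)) * x₀ - (j : ℝ) * y₀) / 2 ^ (j + 1) ∧
      y j = ((j : ℝ) * x₀ + (2 - (j : ℝ)) * y₀) / 2 ^ (j + 1) := by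
  intro j
  induction j with
  | zero =>
    rw [hx0, hy0]
    constructor <;> norm_num
  | succ k ih =>
    obtain ⟨h1, h2⟩ := ih
    rw [hx, hy, h1, h2]
    push_cast
    constructor
    · rw [pow_succ (2 : ℝ) (k + 1)]
      field_simp
      ring
    · rw [pow_succ (2 : ℝ) (k + 1)]
      field_simp
      ring
end

section
/- Let δ₀, δ₁ ∈ ℝ with δ₀ ≠ δ₁, and let e⁰ > 0. Define sequences (x_j), (y_j) by x₀ = δ₀, y₀ = δ₁, x_{j+1} = (3·x_j − y_j)/4, y_{j+1} = (x_j + y_j)/4; define α_j = (x_{j−1} + y_{j−1})/8 for j ≥ 1, and assume |α_j| < π/2 for all j ≥ 1; define e_0 = e⁰ and e_j = e_{j−1}/(2·cos(α_j)) for j ≥ 1. Then the quotient x_j/e_j tends to +∞ if δ₀ > δ₁, and tends to −∞ if δ₀ < δ₁, as j → ∞. -/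
open Filter Real
open scoped Topology

theorem aux_lower (R a : ℕ → ℝ) (hR : ∀ j, 0 < R j)
    (hstep : ∀ j, R (j + 1) = R j * Real.cos (a j))
    (ha : Tendsto (fun j : ℕ => ((j : ℝ) + 2) * a j) atTop (𝓝 0)) :
    ∃ c : ℝ, 0 < c ∧ ∀ᶠ j in atTop, c ≤ R j := by
  have h1 : ∀ᶠ j : ℕ in atTop, |((j : ℝ) + 2) * a j| < 1 := by
    have := ha.abs
    rw [abs_zero] at this
    exact this.eventually (gt_mem_nhds one_pos)
  obtain ⟨N, hN⟩ := eventually_atTop.1 h1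
  have key : ∀ j, N ≤ j →
      R N * ((N : ℝ) + 1) / ((N : ℝ) + 2) * (((j : ℝ) + 2) / ((j : ℝ) + 1)) ≤ R j := by
    intro j hj
    induction j, hj using Nat.le_induction with
    | base => apply le_of_eq; field_simp
    | succ j hj ih =>
      have hlt := hN j hj
      have hsq : (((j : ℝ) + 2) * a j) ^ 2 ≤ 1 := by
        rw [sq_le_one_iff_abs_le_one]; exact hlt.le
      have hj0 : (0 : ℝ) ≤ j := Nat.cast_nonneg j
      have hc : ((j : ℝ) + 1) * (j + 3) / ((j : ℝ) + 2) ^ 2 ≤ Real.cos (a j) := by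
        refine le_trans ?_ (Real.one_sub_sq_div_two_le_cos)
        rw [div_le_iff₀ (by positivity)]
        nlinarith
      rw [hstep]
      refine le_trans (le_of_eq ?_) (mul_le_mul ih hc (by positivity) (hR j).le)
      push_cast
      field_simp
      ring
  refine ⟨R N * ((N : ℝ) + 1) / ((N : ℝ) + 2), ?_, eventually_atTop.2 ⟨N, fun j hj => ?_⟩⟩
  · have := hR N
    positivity
  · refine le_trans ?_ (key j hj)
    have := hR N
    have h2 : 1 ≤ ((j : ℝ) + 2) / ((j : ℝ) + 1) := by
      rw [one_le_div (by positivity)]; linarith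
    exact le_mul_of_one_le_right (by positivity) h2

/-- Analytic content of Proposition A.1: for the planar angle-based 4-point
scheme applied to a symmetric five-point polygon with `δ₀ ≠ δ₁`, the quotient
of the central angular defect by the central edge length tends to `±∞`. -/
theorem central_defect_over_edge_unbounded
    (δ₀ δ₁ e₀ : ℝ) (hne : δ₀ ≠ δ₁) (he₀ : 0 < e₀)
    (x y α e : ℕ → ℝ)
    (hx0 : x 0 = δ₀) (hy0 : y 0 = δ₁)
    (hx : ∀ j : ℕ, x (j + 1) = (3 * x j - y j) / 4)
    (hy : ∀ j : ℕ, y (j + 1) = (x j + y j) / 4)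
    (hα : ∀ j : ℕ, α (j + 1) = (x j + y j) / 8)
    (hαb : ∀ j : ℕ, 1 ≤ j → |α j| < Real.pi / 2)
    (he0 : e 0 = e₀)
    (he : ∀ j : ℕ, e (j + 1) = e j / (2 * Real.cos (α (j + 1)))) :
    (δ₀ > δ₁ → Tendsto (fun j : ℕ => x j / e j) atTop atTop) ∧
    (δ₀ < δ₁ → Tendsto (fun j : ℕ => x j / e j) atTop atBot) := by
  have hxy : ∀ j : ℕ, x j * 2 ^ j = δ₀ + j * ((δ₀ - δ₁) / 2) ∧
      y j * 2 ^ j = δ₁ + j * ((δ₀ - δ₁) / 2) := by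
    intro j
    induction j with
    | zero => simp [hx0, hy0]
    | succ j ih =>
      obtain ⟨h1, h2⟩ := ih
      rw [hx, hy, pow_succ]
      push_cast
      constructor <;> linarith
  have hcos : ∀ j, 0 < Real.cos (α (j + 1)) := by
    intro j
    have := abs_lt.1 (hαb (j + 1) (by omega))
    exact Real.cos_pos_of_mem_Ioo ⟨by linarith [this.1], this.2⟩
  have hepos : ∀ j, 0 < e j := by
    intro j
    induction j with
    | zero => rw [he0]; exact he₀
    | succ j ih =>
      rw [he]
      have := hcos j
      positivity
  have hlim : Tendsto (fun j : ℕ => ((j : ℝ) + 2) * α (j + 1)) atTop (𝓝 0) := by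
    have t := fun k : ℕ => tendsto_pow_const_div_const_pow_of_one_lt k (one_lt_two (α := ℝ))
    have := (((t 2).const_mul ((δ₀ - δ₁) / 8)).add
      ((t 1).const_mul ((δ₀ + δ₁ + 2 * (δ₀ - δ₁)) / 8))).add
      ((t 0).const_mul (2 * (δ₀ + δ₁) / 8))
    simp only [mul_zero, add_zero] at this
    refine this.congr fun j => ?_
    obtain ⟨h1, h2⟩ := hxy j
    have h1' : x j = (δ₀ + j * ((δ₀ - δ₁) / 2)) / 2 ^ j := by
      rw [← h1]; field_simp
    have h2' : y j = (δ₁ + j * ((δ₀ - δ₁) / 2)) / 2 ^ j := by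
      rw [← h2]; field_simp
    rw [hα, h1', h2']
    field_simp
    ring
  obtain ⟨c, hc, hcR⟩ := aux_lower (fun j => 1 / (2 ^ j * e j)) (fun j => α (j + 1))
    (fun j => by have := hepos j; positivity)
    (fun j => by
      have h1 := (hepos j).ne'
      have h2 := (hcos j).ne'
      simp only [he j, pow_succ]
      field_simp) hlim
  have hq : ∀ j : ℕ, x j / e j = (δ₀ + j * ((δ₀ - δ₁) / 2)) * (1 / (2 ^ j * e j)) := by
    intro j
    have h1 := (hepos j).ne'
    rw [← (hxy j).1]
    field_simp
  constructor
  · intro hd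
    have hT : Tendsto (fun j : ℕ => δ₀ + (j : ℝ) * ((δ₀ - δ₁) / 2)) atTop atTop :=
      tendsto_atTop_add_const_left _ _
        (tendsto_natCast_atTop_atTop.atTop_mul_const (by linarith))
    refine tendsto_atTop_mono' _ ?_ (hT.atTop_mul_const hc)
    filter_upwards [hcR, hT.eventually_ge_atTop 0] with j h1 h2
    rw [hq]
    exact mul_le_mul_of_nonneg_left h1 h2
  · intro hd
    have hT : Tendsto (fun j : ℕ => δ₀ + (j : ℝ) * ((δ₀ - δ₁) / 2)) atTop atBot :=
      tendsto_atBot_add_const_left _ _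
        (tendsto_natCast_atTop_atTop.atTop_mul_const_of_neg (by linarith))
    refine tendsto_atBot_mono' _ ?_ (hT.atBot_mul_const hc)
    filter_upwards [hcR, hT.eventually_le_atBot 0] with j h1 h2
    rw [hq]
    exact mul_le_mul_of_nonpos_left h1 h2
end
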